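/- arXiv:1011.2997 — 2 statements merged into one kernel-verified Lean document; each statement's English description precedes it below -/
import Mathlib

section
/- The algebra I₁ is left and right coherent: every finitely generated left ideal of I₁ is finitely presented as a left I₁-module, and every finitely generated right ideal of I₁ is finitely presented as a right I₁-module. -/
open Polynomial

noncomputable section
set_option synthInstance.maxHeartbeats 1000000
set_option maxHeartbeats 1000000
set_option linter.unusedSectionVars false

variable (K : Type*) [Field K] [CharZero K]

/-- The derivative operator `∂ = d/dx` on `K[x]`. -/
def derOp : Module.End K (Polynomial K) := Polynomial.derivative

/-- The multiplication-by-`x` operator on `K[x]`. -/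
def xOp : Module.End K (Polynomial K) := LinearMap.mulLeft K Polynomial.X

/-- The integration operator `∫`, determined by `∫ xⁿ = xⁿ⁺¹/(n+1)`. -/
def intOp : Module.End K (Polynomial K) :=
  (Polynomial.basisMonomials K).constr K fun n => ((n : K) + 1)⁻¹ • X ^ (n + 1)

/-- The algebra `I₁` of polynomial integro-differential operators: the subalgebra of
`End_K(K[x])` generated by `x`, `∂` and `∫`. -/
def I1 : Subalgebra K (Module.End K (Polynomial K)) :=
  Algebra.adjoin K {xOp K, derOp K, intOp K}

/-- `e_{ij} := ∫^i ∂^j − ∫^{i+1} ∂^{j+1}`. -/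
def eOp (i j : ℕ) : Module.End K (Polynomial K) :=
  intOp K ^ i * derOp K ^ j - intOp K ^ (i + 1) * derOp K ^ (j + 1)

/-- `F`, the `K`-linear span of the `e_{ij}`; it is the (two-sided) ideal of compact
operators of `I₁`. -/
def Fset : Submodule K (Module.End K (Polynomial K)) :=
  Submodule.span K {f | ∃ i j, f = eOp K i j}

lemma xOp_mem : xOp K ∈ I1 K := Algebra.subset_adjoin (by simp)
lemma derOp_mem : derOp K ∈ I1 K := Algebra.subset_adjoin (by simp)
lemma intOp_mem : intOp K ∈ I1 K := Algebra.subset_adjoin (by simp)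

lemma eOp_mem (i j : ℕ) : eOp K i j ∈ I1 K :=
  sub_mem (mul_mem (pow_mem (intOp_mem K) i) (pow_mem (derOp_mem K) j))
    (mul_mem (pow_mem (intOp_mem K) (i + 1)) (pow_mem (derOp_mem K) (j + 1)))

/-- `e_{ij}` as an element of the ring `I₁`. -/
def eI (i j : ℕ) : I1 K := ⟨eOp K i j, eOp_mem K i j⟩

/-- `∂` as an element of the ring `I₁`. -/
def derI : I1 K := ⟨derOp K, derOp_mem K⟩

/-- `∫` as an element of the ring `I₁`. -/
def intI : I1 K := ⟨intOp K, intOp_mem K⟩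

/-- `H := ∂ ∘ x` (first multiply by `x`, then differentiate). -/
def hOp : Module.End K (Polynomial K) := derOp K * xOp K

/-- `K[H]`, the unital subalgebra of `I₁` generated by `H`. -/
def KH : Subalgebra K (Module.End K (Polynomial K)) := Algebra.adjoin K {hOp K}

/-- The action of `a ∈ I₁` on a left `I₁`-module `M`, as a `K`-linear map `a_M : M → M`. -/
def actMap (a : I1 K) (M : Type*) [AddCommGroup M] [Module (I1 K) M] [Module K M]
    [SMulCommClass K (I1 K) M] : M →ₗ[K] M where
  toFun m := a • m
  map_add' := smul_add a
  map_smul' k m := (smul_comm k a m).symm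

/-- Right multiplication `b ↦ b * a` in a ring `R`, as a homomorphism of left `R`-modules. -/
def rmulMap (R : Type*) [Ring R] (a : R) : R →ₗ[R] R where
  toFun b := b * a
  map_add' b c := add_mul b c a
  map_smul' c b := by simp [smul_eq_mul, mul_assoc]

/-- Left multiplication `b ↦ a * b` in a ring `R`, as a homomorphism of right `R`-modules
(i.e. of left `Rᵐᵒᵖ`-modules). -/
def lmulMap (R : Type*) [Ring R] (a : R) : R →ₗ[Rᵐᵒᵖ] R where
  toFun b := a * b
  map_add' b c := mul_add a b c
  map_smul' c b := by simp [MulOpposite.smul_eq_mul_unop, mul_assoc]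

/-- The centralizer `Cen_{I₁}(a) = {b ∈ I₁ : ab = ba}` of `a` in `I₁`, as a subalgebra of
`End_K(K[x])`. -/
def Cen (a : Module.End K (Polynomial K)) : Subalgebra K (Module.End K (Polynomial K)) :=
  I1 K ⊓ Subalgebra.centralizer K {a}

/-- `Cen_F(a) = {f ∈ F : af = fa}`, a `K`-subspace of `End_K(K[x])`. -/
def CenF (a : Module.End K (Polynomial K)) : Submodule K (Module.End K (Polynomial K)) :=
  Fset K ⊓ Subalgebra.toSubmodule (Subalgebra.centralizer K {a})


/-- The cokernel `R ⧸ Im f` of a homomorphism of left `R`-modules `f : R → R`. -/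
abbrev Coker (R : Type*) [Ring R] (f : R →ₗ[R] R) : Type _ := R ⧸ LinearMap.range f

/-- The cokernel `R ⧸ Im f` of a homomorphism of right `R`-modules `f : R → R`. -/
abbrev CokerOp (R : Type*) [Ring R] (f : R →ₗ[Rᵐᵒᵖ] R) : Type _ := R ⧸ LinearMap.range f

/-- A module is finitely presented if it is the cokernel of a homomorphism between finitely
generated free modules. -/
def IsFinitelyPresentedMod (R : Type*) [Ring R] (M : Type*) [AddCommMonoid M]
    [Module R M] : Prop :=
  ∃ (n m : ℕ) (f : (Fin m → R) →ₗ[R] (Fin n → R)),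
    Nonempty ((((Fin n → R) ⧸ LinearMap.range f)) ≃ₗ[R] M)

/-- Operators `d`, `s`, `h` generating `R` and satisfying the relations of the derivative `∂`,
the integration `∫` and `H = ∂x`. These relations are invariant under passing to the opposite
ring and exchanging `d` and `s`. -/
structure IntegroDiffData (K R : Type*) [Field K] [Ring R] [Algebra K R] where
  /-- the abstract derivative -/
  d : R
  /-- the abstract integration -/
  s : R
  /-- the abstract Euler-type operator -/
  h : R
  d_mul_s : d * s = 1
  h_mul_d : h * d = d * h - d
  s_mul_h : s * h = h * s - s
  idem_mul_h : (1 - s * d) * h = 1 - s * d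
  h_mul_idem : h * (1 - s * d) = 1 - s * d
  idem_ne_zero : 1 - s * d ≠ 0
  eq_top : ∀ S : Subalgebra K R, d ∈ S → s ∈ S → h ∈ S → S = ⊤

namespace IntegroDiffData

section

variable {K R : Type*} [Field K] [Ring R] [Algebra K R]

/-- The data on the opposite ring, with derivative and integration exchanged. -/
def op (D : IntegroDiffData K R) : IntegroDiffData K Rᵐᵒᵖ where
  d := MulOpposite.op D.s
  s := MulOpposite.op D.d
  h := MulOpposite.op D.h
  d_mul_s := by rw [← MulOpposite.op_mul, D.d_mul_s, MulOpposite.op_one]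
  h_mul_d := by
    rw [← MulOpposite.op_mul, D.s_mul_h, MulOpposite.op_sub, MulOpposite.op_mul]
  s_mul_h := by
    rw [← MulOpposite.op_mul, D.h_mul_d, MulOpposite.op_sub, MulOpposite.op_mul]
  idem_mul_h := by
    simpa using congrArg MulOpposite.op D.h_mul_idem
  h_mul_idem := by
    simpa using congrArg MulOpposite.op D.idem_mul_h
  idem_ne_zero := fun H => D.idem_ne_zero (MulOpposite.op_injective (by simpa using H))
  eq_top S hd hs hh := by
    have h1 := D.eq_top S.unop hs hd hh
    rw [← Subalgebra.op_unop S, h1, Subalgebra.op_top]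

variable (D : IntegroDiffData K R)

/-- The projection onto the constants. -/
def e : R := 1 - D.s * D.d

lemma e_mul_s : D.e * D.s = 0 := by
  rw [e, sub_mul, one_mul, mul_assoc, D.d_mul_s, mul_one, sub_self]

lemma d_pow_mul_s_pow (n : ℕ) : D.d ^ n * D.s ^ n = 1 := by
  induction n with
  | zero => simp
  | succ n ih =>
    rw [pow_succ, pow_succ', mul_assoc, ← mul_assoc D.d, D.d_mul_s, one_mul, ih]

lemma _root_.SemiconjBy.aeval_right {a x y : R} (H : SemiconjBy a x y) (q : K[X]) :
    SemiconjBy a (aeval x q) (aeval y q) := by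
  induction q using Polynomial.induction_on' with
  | add p q hp hq => simpa using hp.add_right hq
  | monomial n c =>
    rw [aeval_monomial, aeval_monomial]
    exact SemiconjBy.mul_right (Algebra.commutes c a).symm (H.pow_right n)

lemma d_pow_mul_h (k : ℕ) : D.d ^ k * D.h = (D.h + (k : R)) * D.d ^ k := by
  induction k with
  | zero => simp
  | succ k ih =>
    have h1 : D.d * D.h = (D.h + 1) * D.d := by
      rw [add_mul, D.h_mul_d, one_mul, sub_add_cancel]
    rw [pow_succ, mul_assoc, h1, ← mul_assoc, mul_add, ih, mul_one]
    push_cast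
    noncomm_ring

lemma d_pow_mul_aeval (k : ℕ) (q : K[X]) :
    D.d ^ k * aeval D.h q = aeval D.h (q.comp (X + C (k : K))) * D.d ^ k := by
  have := (SemiconjBy.aeval_right (K := K) (D.d_pow_mul_h k : SemiconjBy _ _ _) q).eq
  rw [this, aeval_comp]
  simp

lemma aeval_mul_d_pow (k : ℕ) (q : K[X]) :
    aeval D.h q * D.d ^ k = D.d ^ k * aeval D.h (q.comp (X - C (k : K))) := by
  rw [d_pow_mul_aeval, comp_assoc]
  simp

lemma aeval_mul_s (q : K[X]) :
    aeval D.h q * D.s = D.s * aeval D.h (q.comp (X + C 1)) := by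
  have : SemiconjBy D.s (D.h + 1) D.h := by
    rw [SemiconjBy, mul_add, D.s_mul_h, mul_one, sub_add_cancel]
  rw [← (this.aeval_right q).eq, aeval_comp]
  simp

lemma e_mul_aeval (q : K[X]) : D.e * aeval D.h q = q.eval 1 • D.e := by
  induction q using Polynomial.induction_on' with
  | add p q hp hq => rw [map_add, mul_add, hp, hq, eval_add, add_smul]
  | monomial n c =>
    have : D.e * D.h ^ n = D.e := by
      induction n with
      | zero => simp
      | succ n ih => rw [pow_succ, ← mul_assoc, ih]; exact D.idem_mul_h
    rw [aeval_monomial, ← mul_assoc, ← Algebra.commutes, mul_assoc, this]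
    simp [Algebra.smul_def]

lemma e_mul_d_pow_mul_aeval (m : ℕ) (q : K[X]) :
    D.e * D.d ^ m * aeval D.h q = q.eval ((m + 1 : ℕ) : K) • (D.e * D.d ^ m) := by
  rw [mul_assoc, d_pow_mul_aeval, ← mul_assoc, e_mul_aeval, smul_mul_assoc]
  simp [add_comm]

lemma e_mul_d_pow_succ_mul_s (m : ℕ) : D.e * D.d ^ (m + 1) * D.s = D.e * D.d ^ m := by
  rw [pow_succ, mul_assoc, mul_assoc (D.d ^ m), D.d_mul_s, mul_one]

/-- The span of the `e * d ^ j` with `j < m`. -/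
def W (m : ℕ) : Submodule K R := Submodule.span K ((fun j => D.e * D.d ^ j) '' Set.Iio m)

/-- The span of the `d ^ i * q(h)` with `i < k`. -/
def Q (k : ℕ) : Submodule K R :=
  Submodule.span K {y | ∃ i < k, ∃ q : K[X], y = D.d ^ i * aeval D.h q}

lemma W_mono : Monotone D.W := fun _ _ h =>
  Submodule.span_mono (Set.image_mono (Set.Iio_subset_Iio h))

lemma Q_mono : Monotone D.Q := fun _ _ h =>
  Submodule.span_mono fun _ ⟨i, hi, q⟩ => ⟨i, hi.trans_le h, q⟩

lemma e_mul_d_pow_mem {j m : ℕ} (h : j < m) : D.e * D.d ^ j ∈ D.W m :=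
  Submodule.subset_span ⟨j, h, rfl⟩

lemma d_pow_mul_aeval_mem {i k : ℕ} (h : i < k) (q : K[X]) : D.d ^ i * aeval D.h q ∈ D.Q k :=
  Submodule.subset_span ⟨i, h, q, rfl⟩

lemma Q_zero : D.Q 0 = ⊥ := by simp [Q]

lemma W_fg (m : ℕ) : (D.W m).FG :=
  Submodule.fg_span ((Set.finite_Iio m).image _)

lemma Q_induction {k : ℕ} {N : Submodule K R} (f : R →ₗ[K] R)
    (H : ∀ i < k, ∀ q : K[X], f (D.d ^ i * aeval D.h q) ∈ N) {x : R} (hx : x ∈ D.Q k) :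
    f x ∈ N := by
  have : D.Q k ≤ N.comap f := by
    refine Submodule.span_le.2 ?_
    rintro _ ⟨i, hi, q, rfl⟩
    exact H i hi q
  exact this hx

lemma W_induction {m : ℕ} {N : Submodule K R} (f : R →ₗ[K] R)
    (H : ∀ j < m, f (D.e * D.d ^ j) ∈ N) {x : R} (hx : x ∈ D.W m) : f x ∈ N := by
  have : D.W m ≤ N.comap f := by
    refine Submodule.span_le.2 ?_
    rintro _ ⟨j, hj, rfl⟩
    exact H j hj
  exact this hx

lemma exists_sub_mem_Q {k : ℕ} {x : R} (hx : x ∈ D.Q (k + 1)) :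
    ∃ c : K[X], x - D.d ^ k * aeval D.h c ∈ D.Q k := by
  refine Submodule.span_induction (p := fun x _ => ∃ c : K[X], x - D.d ^ k * aeval D.h c ∈ D.Q k)
    ?_ ⟨0, by simp⟩ ?_ ?_ hx
  · rintro _ ⟨i, hi, q, rfl⟩
    obtain hi | rfl := Nat.lt_succ_iff_lt_or_eq.1 hi
    · exact ⟨0, by simpa using D.d_pow_mul_aeval_mem hi q⟩
    · exact ⟨q, by simp⟩
  · rintro x y - - ⟨a, ha⟩ ⟨b, hb⟩
    refine ⟨a + b, ?_⟩
    rw [map_add, mul_add, add_sub_add_comm]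
    exact add_mem ha hb
  · rintro t x - ⟨a, ha⟩
    refine ⟨t • a, ?_⟩
    rw [map_smul, mul_smul_comm, ← smul_sub]
    exact Submodule.smul_mem _ _ ha

lemma exists_sub_mem_W {k : ℕ} {x : R} (hx : x ∈ D.W (k + 1)) :
    ∃ c : K, x - c • (D.e * D.d ^ k) ∈ D.W k := by
  rw [W, ← Order.succ_eq_add_one, Order.Iio_succ_eq_insert, Set.image_insert_eq, Submodule.mem_span_insert] at hx
  obtain ⟨c, z, hz, rfl⟩ := hx
  exact ⟨c, by rw [add_sub_cancel_left]; exact hz⟩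

lemma d_pow_mul_mem_Q {k : ℕ} (n : ℕ) {x : R} (hx : x ∈ D.Q k) : D.d ^ n * x ∈ D.Q (n + k) :=
  D.Q_induction (LinearMap.mulLeft K (D.d ^ n)) (fun i hi q => by
    rw [LinearMap.mulLeft_apply, ← mul_assoc, ← pow_add]
    exact D.d_pow_mul_aeval_mem (by lia) q) hx

lemma aeval_mul_mem_Q {k : ℕ} (p : K[X]) {x : R} (hx : x ∈ D.Q k) :
    aeval D.h p * x ∈ D.Q k :=
  D.Q_induction (LinearMap.mulLeft K (aeval D.h p)) (fun i hi q => by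
    rw [LinearMap.mulLeft_apply, ← mul_assoc, aeval_mul_d_pow, mul_assoc, ← map_mul]
    exact D.d_pow_mul_aeval_mem hi _) hx

lemma e_mul_d_pow_mul_mem_W {k : ℕ} (j : ℕ) {x : R} (hx : x ∈ D.Q k) :
    D.e * D.d ^ j * x ∈ D.W (j + k) :=
  D.Q_induction (LinearMap.mulLeft K (D.e * D.d ^ j)) (fun i hi q => by
    rw [LinearMap.mulLeft_apply, ← mul_assoc, mul_assoc D.e, ← pow_add, e_mul_d_pow_mul_aeval]
    exact Submodule.smul_mem _ _ (D.e_mul_d_pow_mem (by lia))) hx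

lemma exists_d_pow_mul_mem_Q (a : R) : ∃ N k, D.d ^ N * a ∈ D.Q k := by
  let T : Submodule K R :=
    { carrier := {a | ∃ N k, D.d ^ N * a ∈ D.Q k}
      zero_mem' := ⟨0, 0, by simp⟩
      add_mem' := by
        rintro a b ⟨N, k, ha⟩ ⟨M, l, hb⟩
        refine ⟨N + M, N + M + k + l, ?_⟩
        rw [mul_add]
        refine add_mem ?_ ?_
        · rw [add_comm N M, pow_add, mul_assoc]
          exact D.Q_mono (by lia) (D.d_pow_mul_mem_Q M ha)
        · rw [pow_add, mul_assoc]
          exact D.Q_mono (by lia) (D.d_pow_mul_mem_Q N hb)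
      smul_mem' := by
        rintro t a ⟨N, k, ha⟩
        exact ⟨N, k, by rw [mul_smul_comm]; exact Submodule.smul_mem _ _ ha⟩ }
  let S : Subalgebra K R :=
    { carrier := {b | ∀ a ∈ T, a * b ∈ T}
      add_mem' := fun hb hc a ha => by rw [mul_add]; exact add_mem (hb a ha) (hc a ha)
      mul_mem' := fun hb hc a ha => by rw [← mul_assoc]; exact hc _ (hb a ha)
      algebraMap_mem' := fun t a ha => by
        rw [← Algebra.commutes, ← Algebra.smul_def]; exact T.smul_mem t ha }
  have hS : S = ⊤ := by
    refine D.eq_top S ?_ ?_ ?_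
    · rintro a ⟨N, k, ha⟩
      refine ⟨N, k + 1, ?_⟩
      rw [← mul_assoc]
      refine D.Q_induction (LinearMap.mulRight K D.d) (fun i hi q => ?_) ha
      have := D.aeval_mul_d_pow 1 q
      rw [pow_one] at this
      rw [LinearMap.mulRight_apply, mul_assoc, this, ← mul_assoc, ← pow_succ]
      exact D.d_pow_mul_aeval_mem (by lia) _
    · rintro a ⟨N, k, ha⟩
      refine ⟨N + 1, k, ?_⟩
      rw [pow_succ', mul_assoc, ← mul_assoc (D.d ^ N)]
      refine D.Q_induction (LinearMap.mulLeft K D.d ∘ₗ LinearMap.mulRight K D.s)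
        (fun i hi q => ?_) ha
      have : D.d * (D.d ^ i * aeval D.h q * D.s) = D.d ^ i * aeval D.h (q.comp (X + C 1)) := by
        rw [mul_assoc, aeval_mul_s, ← mul_assoc, ← mul_assoc, ← pow_succ', pow_succ,
          mul_assoc (D.d ^ i), D.d_mul_s, mul_one]
      rw [LinearMap.comp_apply, LinearMap.mulRight_apply, LinearMap.mulLeft_apply, this]
      exact D.d_pow_mul_aeval_mem hi _
    · rintro a ⟨N, k, ha⟩
      refine ⟨N, k, ?_⟩
      rw [← mul_assoc]
      refine D.Q_induction (LinearMap.mulRight K D.h) (fun i hi q => ?_) ha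
      have : aeval D.h q * D.h = aeval D.h (q * X) := by simp
      rw [LinearMap.mulRight_apply, mul_assoc, this]
      exact D.d_pow_mul_aeval_mem hi _
  have ha : a ∈ S := hS ▸ Algebra.mem_top
  have h1 : (1 : R) ∈ T := ⟨0, 1, by simpa using D.d_pow_mul_aeval_mem zero_lt_one 1⟩
  have h2 : 1 * a ∈ T := ha 1 h1
  rw [one_mul] at h2
  exact h2

lemma exists_forall_mul_mem_W (b : R) (m : ℕ) : ∃ n, ∀ a ∈ D.W m, a * b ∈ D.W n := by
  let S : Subalgebra K R :=
    { carrier := {b | ∀ m, ∃ n, ∀ a ∈ D.W m, a * b ∈ D.W n}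
      add_mem' := fun hb hc m => by
        obtain ⟨n, hn⟩ := hb m
        obtain ⟨l, hl⟩ := hc m
        refine ⟨max n l, fun a ha => ?_⟩
        rw [mul_add]
        exact add_mem (D.W_mono (le_max_left _ _) (hn a ha))
          (D.W_mono (le_max_right _ _) (hl a ha))
      mul_mem' := fun hb hc m => by
        obtain ⟨n, hn⟩ := hb m
        obtain ⟨l, hl⟩ := hc n
        refine ⟨l, fun a ha => ?_⟩
        rw [← mul_assoc]
        exact hl _ (hn a ha)
      algebraMap_mem' := fun t m => ⟨m, fun a ha => by
        rw [← Algebra.commutes, ← Algebra.smul_def]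
        exact Submodule.smul_mem _ t ha⟩ }
  have hS : S = ⊤ := by
    refine D.eq_top S (fun m => ⟨m + 1, fun a ha => ?_⟩) (fun m => ⟨m, fun a ha => ?_⟩)
      (fun m => ⟨m, fun a ha => ?_⟩)
    · refine D.W_induction (LinearMap.mulRight K D.d) (fun j hj => ?_) ha
      rw [LinearMap.mulRight_apply, mul_assoc, ← pow_succ]
      exact D.e_mul_d_pow_mem (by lia)
    · refine D.W_induction (LinearMap.mulRight K D.s) (fun j hj => ?_) ha
      rw [LinearMap.mulRight_apply]
      cases j with
      | zero => simp [e_mul_s]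
      | succ j =>
        rw [e_mul_d_pow_succ_mul_s]
        exact D.e_mul_d_pow_mem (by lia)
    · refine D.W_induction (LinearMap.mulRight K D.h) (fun j hj => ?_) ha
      have := D.e_mul_d_pow_mul_aeval j X
      rw [aeval_X] at this
      rw [LinearMap.mulRight_apply, this]
      exact Submodule.smul_mem _ _ (D.e_mul_d_pow_mem hj)
  have hb : b ∈ S := hS ▸ Algebra.mem_top
  exact hb m

lemma exists_e_mul_mem_W (a : R) : ∃ m, D.e * a ∈ D.W m := by
  obtain ⟨n, hn⟩ := D.exists_forall_mul_mem_W a 1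
  exact ⟨n, hn _ (by simpa using D.e_mul_d_pow_mem zero_lt_one)⟩

lemma e_mul_d_pow_notMem_W (t : ℕ) : D.e * D.d ^ t ∉ D.W t := by
  intro H
  have key : ∀ j n, j < n → D.e * D.d ^ j * D.s ^ n = 0 := by
    intro j n hjn
    obtain ⟨k, rfl⟩ := Nat.exists_eq_add_of_lt hjn
    rw [add_assoc, pow_add, mul_assoc, ← mul_assoc (D.d ^ j), d_pow_mul_s_pow, one_mul, pow_succ',
      ← mul_assoc, e_mul_s, zero_mul]
  have h0 : D.e * D.d ^ t * D.s ^ t ∈ (⊥ : Submodule K R) :=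
    D.W_induction (LinearMap.mulRight K (D.s ^ t)) (fun j hj => key j t hj) H
  rw [mul_assoc, d_pow_mul_s_pow, mul_one, Submodule.mem_bot] at h0
  exact D.idem_ne_zero h0

/-- The ideal of compact operators, described as the elements killed by a power of `d`. -/
def F : Ideal R where
  carrier := {a | ∃ N, D.d ^ N * a = 0}
  zero_mem' := ⟨0, by simp⟩
  add_mem' := by
    rintro a b ⟨N, ha⟩ ⟨M, hb⟩
    refine ⟨N + M, ?_⟩
    rw [mul_add, pow_add, mul_assoc _ _ b, hb, ← pow_add, add_comm N, pow_add, mul_assoc, ha]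
    simp
  smul_mem' := by
    rintro r a ⟨N, ha⟩
    obtain ⟨M, k, hr⟩ := D.exists_d_pow_mul_mem_Q r
    refine ⟨N + M, ?_⟩
    rw [pow_add, smul_eq_mul, mul_assoc, ← mul_assoc (D.d ^ M)]
    refine (Submodule.mem_bot K).1 <| D.Q_induction
      (LinearMap.mulLeft K (D.d ^ N) ∘ₗ LinearMap.mulRight K a) (fun i hi q => ?_) hr
    rw [LinearMap.comp_apply, LinearMap.mulRight_apply, LinearMap.mulLeft_apply,
      ← mul_assoc, ← mul_assoc, ← pow_add, add_comm, pow_add, mul_assoc (D.d ^ i),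
      d_pow_mul_aeval, mul_assoc, mul_assoc, ha]
    simp

lemma d_pow_mul_mem_F {a : R} {N : ℕ} : D.d ^ N * a ∈ D.F ↔ a ∈ D.F := by
  refine ⟨fun ⟨M, hM⟩ => ⟨M + N, ?_⟩, fun h => D.F.mul_mem_left _ h⟩
  rw [pow_add, mul_assoc, hM]

lemma d_pow_notMem_F (N : ℕ) : D.d ^ N ∉ D.F := by
  rintro ⟨M, hM⟩
  have h1 := D.d_pow_mul_s_pow (M + N)
  rw [pow_add, hM, zero_mul] at h1
  refine D.idem_ne_zero ?_
  rw [← one_mul (1 - D.s * D.d), ← h1, zero_mul]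

/-- An element of a left ideal killed by a power of `d` lies in the left ideal generated by
the elements of `eR` in it. -/
lemma mem_of_mem_F {J G : Ideal R} (H : ∀ m, ∀ y ∈ J, y ∈ D.W m → y ∈ G) {a : R}
    (ha : a ∈ J) (haF : a ∈ D.F) : a ∈ G := by
  obtain ⟨N, hN⟩ := haF
  induction N generalizing a with
  | zero =>
    rw [pow_zero, one_mul] at hN
    exact hN ▸ G.zero_mem
  | succ N ih =>
    have h1 := ih (J.mul_mem_left D.d ha) (by rw [← mul_assoc, ← pow_succ, hN])
    obtain ⟨m, hm⟩ := D.exists_e_mul_mem_W a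
    have h2 : a = D.s * (D.d * a) + D.e * a := by rw [e]; noncomm_ring
    rw [h2]
    exact add_mem (G.mul_mem_left _ h1) (H m _ (J.mul_mem_left _ ha) hm)

lemma exists_lead {k : ℕ} {p : R} (hp : p ∈ D.Q k) (h0 : p ≠ 0) :
    ∃ (n : ℕ) (c : K[X]), c ≠ 0 ∧ p - D.d ^ n * aeval D.h c ∈ D.Q n := by
  induction k with
  | zero =>
    rw [Q_zero, Submodule.mem_bot] at hp
    exact absurd hp h0
  | succ k ih =>
    obtain ⟨c, hc⟩ := D.exists_sub_mem_Q hp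
    obtain rfl | hc0 := eq_or_ne c 0
    · exact ih (by simpa using hc)
    · exact ⟨k, c, hc0, hc⟩

lemma exists_lead_mul [CharZero K] {k : ℕ} {p : R} (hp : p ∈ D.Q k) (h0 : p ≠ 0) :
    ∃ n J : ℕ, ∀ j ≥ J, ∃ c : K, c ≠ 0 ∧
      D.e * D.d ^ j * p - c • (D.e * D.d ^ (j + n)) ∈ D.W (j + n) := by
  obtain ⟨n, q, hq, hpq⟩ := D.exists_lead hp h0
  have hfin : {t : ℕ | q.eval (t : K) = 0}.Finite :=
    (q.finite_setOfPred_isRoot hq).preimage Nat.cast_injective.injOn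
  obtain ⟨J, hJ⟩ := hfin.bddAbove
  refine ⟨n, J, fun j hj => ⟨q.eval ((j + n + 1 : ℕ) : K), fun H => ?_, ?_⟩⟩
  · have : j + n + 1 ≤ J := hJ H
    lia
  · rw [← e_mul_d_pow_mul_aeval, pow_add, ← mul_assoc, mul_assoc (D.e * D.d ^ j) (D.d ^ n),
      ← mul_sub]
    exact D.e_mul_d_pow_mul_mem_W j hpq

/-- The leading coefficients in degree `k` of the elements of a left ideal. -/
def lead (J : Ideal R) (k : ℕ) : Ideal K[X] where
  carrier := {c | ∃ y ∈ J, y - D.d ^ k * aeval D.h c ∈ D.Q k}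
  zero_mem' := ⟨0, J.zero_mem, by simp⟩
  add_mem' := by
    rintro a b ⟨y, hy, ha⟩ ⟨z, hz, hb⟩
    refine ⟨y + z, add_mem hy hz, ?_⟩
    rw [map_add, mul_add, add_sub_add_comm]
    exact add_mem ha hb
  smul_mem' := by
    rintro a c ⟨y, hy, hc⟩
    refine ⟨aeval D.h (a.comp (X + C (k : K))) * y, J.mul_mem_left _ hy, ?_⟩
    rw [smul_eq_mul, map_mul, ← mul_assoc, d_pow_mul_aeval, mul_assoc _ (D.d ^ k), ← mul_sub]
    exact D.aeval_mul_mem_Q _ hc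

lemma lead_mono {J G : Ideal R} (h : J ≤ G) (k : ℕ) : D.lead J k ≤ D.lead G k :=
  fun _ ⟨y, hy, hc⟩ => ⟨y, h hy, hc⟩

lemma lead_monotone (J : Ideal R) : Monotone (D.lead J) := by
  refine monotone_nat_of_le_succ fun k => ?_
  rintro c ⟨y, hy, hc⟩
  refine ⟨D.d * y, J.mul_mem_left _ hy, ?_⟩
  rw [pow_succ', mul_assoc, ← mul_sub]
  have := D.d_pow_mul_mem_Q 1 hc
  rwa [pow_one, add_comm] at this

lemma mem_of_lead_le {J G : Ideal R} (hG : G ≤ J) (h : ∀ k, D.lead J k ≤ D.lead G k) {k : ℕ}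
    {x : R} (hx : x ∈ J) (hxk : x ∈ D.Q k) : x ∈ G := by
  induction k generalizing x with
  | zero =>
    rw [Q_zero, Submodule.mem_bot] at hxk
    exact hxk ▸ G.zero_mem
  | succ k ih =>
    obtain ⟨c, hc⟩ := D.exists_sub_mem_Q hxk
    obtain ⟨y, hy, hyc⟩ := h k ⟨x, hx, hc⟩
    have h1 : x - y ∈ D.Q k := by simpa using sub_mem hc hyc
    have h2 := ih (sub_mem hx (hG hy)) h1
    simpa using add_mem h2 hy

lemma exists_fg_lead_le (J : Ideal R) (k : ℕ) :
    ∃ G ≤ J, G.FG ∧ D.lead J k ≤ D.lead G k := by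
  obtain ⟨S, hS⟩ := (IsNoetherian.noetherian (D.lead J k))
  have hmem : ∀ c : S, ∃ y ∈ J, y - D.d ^ k * aeval D.h (c : K[X]) ∈ D.Q k := fun c =>
    (hS ▸ Submodule.subset_span c.2 : (c : K[X]) ∈ D.lead J k)
  choose f hfJ hf using hmem
  refine ⟨Submodule.span R (Set.range f), Submodule.span_le.2 (Set.range_subset_iff.2 hfJ),
    Submodule.fg_span (Set.finite_range f), ?_⟩
  rw [← hS]
  exact Submodule.span_le.2 fun c hc => ⟨f ⟨c, hc⟩, Submodule.subset_span ⟨_, rfl⟩, hf ⟨c, hc⟩⟩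

/-- A Hilbert basis theorem for the subring generated by `d` and `h`. -/
lemma exists_fg_forall_mem_Q (J : Ideal R) :
    ∃ G ≤ J, G.FG ∧ ∀ k, ∀ x ∈ J, x ∈ D.Q k → x ∈ G := by
  obtain ⟨m, hm⟩ := monotone_stabilizes_iff_noetherian.2
    (inferInstance : IsNoetherian K[X] K[X]) ⟨D.lead J, D.lead_monotone J⟩
  choose G hGJ hGfg hG using D.exists_fg_lead_le J
  have hle : (Finset.range (m + 1)).sup G ≤ J := Finset.sup_le fun k _ => hGJ k
  refine ⟨(Finset.range (m + 1)).sup G, hle,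
    Submodule.fg_finset_sup _ _ fun k _ => hGfg k, fun k x hx hxk => ?_⟩
  refine D.mem_of_lead_le hle (fun k => ?_) hx hxk
  have key : ∀ k ≤ m, D.lead J k ≤ D.lead ((Finset.range (m + 1)).sup G) k := fun k hk =>
    (hG k).trans (D.lead_mono (Finset.le_sup (Finset.mem_range.2 (by lia))) k)
  obtain hk | hk := le_total k m
  · exact key k hk
  · exact (hm k hk).symm.le.trans ((key m le_rfl).trans (D.lead_monotone _ hk))

lemma fg_span_of_fg {U : Submodule K R} (hU : U.FG) : (Ideal.span (U : Set R)).FG := by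
  obtain ⟨S, rfl⟩ := hU
  refine ⟨S, le_antisymm (Submodule.span_mono Submodule.subset_span) ?_⟩
  exact Submodule.span_le.2 (Submodule.span_le_restrictScalars K R (S : Set R))

lemma fg_span_inter_W (J : Ideal R) (m : ℕ) :
    (Ideal.span {y | y ∈ J ∧ y ∈ D.W m}).FG := by
  have : Module.Finite K (D.W m) := Module.Finite.iff_fg.2 (D.W_fg m)
  have hfg : (J.restrictScalars K ⊓ D.W m).FG := Submodule.FG.of_le (D.W_fg m) inf_le_right
  exact fg_span_of_fg hfg

lemma exists_sub_mem_span [CharZero K] {k : ℕ} {p : R} (hp : p ∈ D.Q k) (h0 : p ≠ 0) :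
    ∃ m₀, ∀ m, ∀ y ∈ D.W m, ∃ u ∈ D.W m₀, y - u ∈ Ideal.span {p} := by
  obtain ⟨n, J, hJ⟩ := D.exists_lead_mul hp h0
  refine ⟨J + n, fun m => ?_⟩
  induction m with
  | zero => exact fun y hy => ⟨y, D.W_mono (Nat.zero_le _) hy, by simp⟩
  | succ m ih =>
    intro y hy
    obtain hm | hm := Nat.lt_or_ge m (J + n)
    · exact ⟨y, D.W_mono hm hy, by simp⟩
    obtain ⟨j, rfl⟩ := Nat.exists_eq_add_of_le' (show n ≤ m by lia)
    obtain ⟨b, hb, hbw⟩ := hJ j (by lia)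
    obtain ⟨c, hc⟩ := D.exists_sub_mem_W hy
    have h1 : y - (c / b) • (D.e * D.d ^ j * p) ∈ D.W (j + n) := by
      have := sub_mem hc (Submodule.smul_mem _ (c / b) hbw)
      rw [smul_sub, smul_smul, div_mul_cancel₀ _ hb] at this
      simpa using this
    obtain ⟨u, hu, hyu⟩ := ih _ h1
    refine ⟨u, hu, ?_⟩
    have h2 : (c / b) • (D.e * D.d ^ j * p) ∈ Ideal.span {p} := by
      rw [← smul_mul_assoc]
      exact Ideal.mul_mem_left _ _ (Ideal.mem_span_singleton_self p)
    have h3 : y - u = y - (c / b) • (D.e * D.d ^ j * p) - u + (c / b) • (D.e * D.d ^ j * p) := by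
      abel
    rw [h3]
    exact add_mem hyu h2

lemma exists_mem_Q_ne_zero {J : Ideal R} (hJ : ¬ J ≤ D.F) : ∃ k, ∃ p ∈ J, p ∈ D.Q k ∧ p ≠ 0 := by
  obtain ⟨a, haJ, haF⟩ := SetLike.not_le_iff_exists.1 hJ
  obtain ⟨N, k, hk⟩ := D.exists_d_pow_mul_mem_Q a
  exact ⟨k, _, J.mul_mem_left _ haJ, hk, fun H => haF ⟨N, H⟩⟩

lemma fg_of_not_le_F [CharZero K] {J : Ideal R} (hJ : ¬ J ≤ D.F) : J.FG := by
  obtain ⟨k, p, hpJ, hpk, hp0⟩ := D.exists_mem_Q_ne_zero hJ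
  obtain ⟨m₀, hm₀⟩ := D.exists_sub_mem_span hpk hp0
  obtain ⟨G, hGJ, hGfg, hG⟩ := D.exists_fg_forall_mem_Q J
  set U : Ideal R := Ideal.span {y | y ∈ J ∧ y ∈ D.W m₀}
  have hUJ : U ≤ J := Submodule.span_le.2 fun y hy => hy.1
  have : J = G ⊔ U := by
    refine le_antisymm (fun a ha => ?_) (sup_le hGJ hUJ)
    obtain ⟨N, l, hl⟩ := D.exists_d_pow_mul_mem_Q a
    have h1 : D.d ^ N * a ∈ G := hG l _ (J.mul_mem_left _ ha) hl
    have h2 : a - D.s ^ N * (D.d ^ N * a) ∈ D.F := ⟨N, by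
      rw [mul_sub, ← mul_assoc (D.d ^ N) (D.s ^ N), d_pow_mul_s_pow, one_mul, sub_self]⟩
    have h3 : a - D.s ^ N * (D.d ^ N * a) ∈ J :=
      sub_mem ha (J.mul_mem_left _ (J.mul_mem_left _ ha))
    have h4 : a - D.s ^ N * (D.d ^ N * a) ∈ G ⊔ U := by
      refine D.mem_of_mem_F (fun m y hyJ hym => ?_) h3 h2
      obtain ⟨u, hu, hyu⟩ := hm₀ m y hym
      have hpG : Ideal.span {p} ≤ G := by
        rw [Ideal.span_le, Set.singleton_subset_iff]
        exact hG k p hpJ hpk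
      have huJ : u ∈ J := by simpa using sub_mem hyJ (hGJ (hpG hyu))
      rw [← sub_add_cancel y u]
      exact Submodule.add_mem_sup (hpG hyu) (Ideal.subset_span ⟨huJ, hu⟩)
    rw [← sub_add_cancel a (D.s ^ N * (D.d ^ N * a))]
    exact add_mem h4 (Submodule.mem_sup_left (G.mul_mem_left _ h1))
  rw [this]
  exact Submodule.FG.sup hGfg (D.fg_span_inter_W J m₀)

/-- An Ore condition modulo `F`. -/
lemma exists_mul_mem [CharZero K] {a : R} (ha : a ∉ D.F) (x : R) :
    ∃ r ∉ D.F, r * x ∈ Ideal.span {a} := by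
  by_contra! H
  let ρ : R →ₗ[R] R := LinearMap.toSpanSingleton R R x
  have hρ : ∀ y, ρ y = y * x := fun y => rfl
  obtain ⟨N, hN0, hN⟩ : ∃ N : ℕ → Ideal R, N 0 = ⊥ ∧
      ∀ n, N (n + 1) = Ideal.span {a} ⊔ Submodule.map ρ (N n) :=
    ⟨fun n => Nat.rec ⊥ (fun _ I => Ideal.span {a} ⊔ Submodule.map ρ I) n, rfl, fun _ => rfl⟩
  have hmono : Monotone N := by
    refine monotone_nat_of_le_succ fun n => ?_
    induction n with
    | zero => exact hN0 ▸ bot_le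
    | succ n ih =>
      rw [hN, hN (n + 1)]
      exact sup_le_sup_left (Submodule.map_mono ih) _
  have hmem : ∀ n, a * x ^ n ∈ N (n + 1) := by
    intro n
    induction n with
    | zero => simpa [hN] using Submodule.mem_sup_left (Ideal.mem_span_singleton_self a)
    | succ n ih =>
      rw [pow_succ, ← mul_assoc, hN (n + 1)]
      exact Submodule.mem_sup_right ⟨_, ih, rfl⟩
  have hnot : ∀ n, ∀ y ∈ N n, a * x ^ n - y ∉ D.F := by
    intro n
    induction n with
    | zero =>
      intro y hy
      have hy0 : y = 0 := by simpa [hN0] using hy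
      simpa [hy0] using ha
    | succ n ih =>
      intro y hy hF
      rw [hN] at hy
      obtain ⟨b, hb, _, ⟨z, hz, rfl⟩, rfl⟩ := Submodule.mem_sup.1 hy
      obtain ⟨M, hM⟩ := hF
      refine H (D.d ^ M * (a * x ^ n - z)) ?_ ?_
      · rw [d_pow_mul_mem_F]
        exact ih z hz
      · have : D.d ^ M * (a * x ^ n - z) * x = D.d ^ M * b := by
          rw [← sub_eq_zero, ← hM, hρ, pow_succ]
          noncomm_ring
        rw [this]
        exact Ideal.mul_mem_left _ _ hb
  have hsup : ¬ iSup N ≤ D.F := fun h =>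
    ha (h (Submodule.mem_iSup_of_mem 1 (by simpa using hmem 0)))
  obtain ⟨n, hn⟩ := Submodule.FG.stabilizes_of_iSup_eq (D.fg_of_not_le_F hsup) ⟨N, hmono⟩ rfl
  have h1 : a * x ^ n ∈ N n := by
    have : N (n + 1) ≤ N n := (le_iSup N (n + 1)).trans hn.le
    exact this (hmem n)
  exact hnot n _ h1 (by simp)

lemma exists_W_of_mul_mem_W [CharZero K] {x : R} (hx : x ∉ D.F) (m : ℕ) :
    ∃ l, ∀ k, ∀ v ∈ D.W k, v * x ∈ D.W m → v ∈ D.W l := by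
  obtain ⟨N, k₀, hk₀⟩ := D.exists_d_pow_mul_mem_Q x
  obtain ⟨n, J, hJ⟩ := D.exists_lead_mul hk₀ fun H => hx ⟨N, H⟩
  have hlead : ∀ j ≥ J, ∃ c : K, c ≠ 0 ∧
      D.e * D.d ^ (j + N) * x - c • (D.e * D.d ^ (j + n)) ∈ D.W (j + n) := by
    intro j hj
    obtain ⟨c, hc⟩ := hJ j hj
    exact ⟨c, by rwa [pow_add, ← mul_assoc, mul_assoc _ _ x]⟩
  obtain ⟨M, hM⟩ := D.exists_forall_mul_mem_W x (J + N)
  have hlt : ∀ j ≥ J, M ≤ j + n → ∀ v ∈ D.W (j + N), v * x ∈ D.W (j + n) := by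
    intro j hj hMj v hv
    refine D.W_induction (LinearMap.mulRight K x) (fun t ht => ?_) hv
    rw [LinearMap.mulRight_apply]
    obtain htJ | htJ := Nat.lt_or_ge t (J + N)
    · exact D.W_mono hMj (hM _ (D.e_mul_d_pow_mem htJ))
    · obtain ⟨i, rfl⟩ := Nat.exists_eq_add_of_le' (show N ≤ t by lia)
      obtain ⟨c, -, hc⟩ := hlead i (by lia)
      rw [← sub_add_cancel (D.e * D.d ^ (i + N) * x) (c • (D.e * D.d ^ (i + n)))]
      exact add_mem (D.W_mono (by lia) hc)
        (Submodule.smul_mem _ _ (D.e_mul_d_pow_mem (by lia)))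
  refine ⟨J + N + M + m, fun k => ?_⟩
  induction k with
  | zero => exact fun v hv _ => D.W_mono (Nat.zero_le _) hv
  | succ k ih =>
    intro v hv hvx
    obtain hk | hk := Nat.lt_or_ge k (J + N + M + m)
    · exact D.W_mono hk hv
    refine ih v ?_ hvx
    obtain ⟨j, rfl⟩ := Nat.exists_eq_add_of_le' (show N ≤ k by lia)
    obtain ⟨c, hc⟩ := D.exists_sub_mem_W hv
    obtain ⟨b, hb, hbw⟩ := hlead j (by lia)
    have h1 := hlt j (by lia) (by lia) _ hc
    have h2 : (c * b) • (D.e * D.d ^ (j + n)) ∈ D.W (j + n) := by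
      have h3 := sub_mem (sub_mem (D.W_mono (show m ≤ j + n by lia) hvx) h1)
        (Submodule.smul_mem _ c hbw)
      rw [sub_mul, smul_mul_assoc, sub_sub_cancel, smul_sub, sub_sub_cancel, smul_smul] at h3
      exact h3
    have hc0 : c = 0 := by
      by_contra hc0
      exact D.e_mul_d_pow_notMem_W _ (((D.W (j + n)).smul_mem_iff (mul_ne_zero hc0 hb)).1 h2)
    simpa [hc0] using hc

lemma exists_W_of_fg_of_le_F {I : Ideal R} (hI : I.FG) (hF : I ≤ D.F) :
    ∃ m, ∀ k, ∀ y ∈ I, y ∈ D.W k → y ∈ D.W m := by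
  have key : ∃ m, ∀ y ∈ I, D.e * y ∈ D.W m := by
    obtain ⟨S, rfl⟩ := hI
    have hS : ∀ a ∈ S, ∃ m, ∀ r : R, D.e * (r * a) ∈ D.W m := by
      intro a ha
      obtain ⟨N, hN⟩ := hF (Ideal.subset_span ha)
      obtain ⟨m, hm⟩ := D.exists_forall_mul_mem_W a N
      refine ⟨m, fun r => ?_⟩
      obtain ⟨k, hk⟩ := D.exists_e_mul_mem_W r
      rw [← mul_assoc]
      refine D.W_induction (LinearMap.mulRight K a) (fun j hj => ?_) hk
      rw [LinearMap.mulRight_apply]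
      obtain hjN | hjN := Nat.lt_or_ge j N
      · exact hm _ (D.e_mul_d_pow_mem hjN)
      · obtain ⟨i, rfl⟩ := Nat.exists_eq_add_of_le' hjN
        rw [pow_add, mul_assoc, mul_assoc, hN, mul_zero, mul_zero]
        exact zero_mem _
    choose! f hf using hS
    have hall : ∀ y ∈ Ideal.span (S : Set R), ∀ r, D.e * (r * y) ∈ D.W (S.sup f) := by
      intro y hy
      induction hy using Submodule.span_induction with
      | mem a ha => exact fun r => D.W_mono (Finset.le_sup ha) (hf a ha r)
      | zero => simp
      | add y z _ _ hy hz =>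
        intro r
        rw [mul_add, mul_add]
        exact add_mem (hy r) (hz r)
      | smul t y _ hy =>
        intro r
        rw [smul_eq_mul, ← mul_assoc r]
        exact hy _
    exact ⟨S.sup f, fun y hy => by simpa using hall y hy 1⟩
  obtain ⟨m, hm⟩ := key
  refine ⟨m, fun k y hyI hyk => ?_⟩
  have h1 : y - D.e * y ∈ (⊥ : Submodule K R) :=
    D.W_induction (LinearMap.id - LinearMap.mulLeft K D.e) (fun j _ => by
      have : D.e * D.e = D.e := by
        conv_lhs => rw [e, mul_sub, mul_one, ← e, ← mul_assoc, e_mul_s, zero_mul, sub_zero]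
      simp [← mul_assoc, this]) hyk
  rw [Submodule.mem_bot, sub_eq_zero] at h1
  rw [h1]
  exact hm y hyI

end

theorem fg_comap {K R : Type*} [Field K] [CharZero K] [Ring R] [Algebra K R]
    (D : IntegroDiffData K R) {I : Ideal R} (hI : I.FG) (x : R) :
    (Submodule.comap (LinearMap.toSpanSingleton R R x) I).FG := by
  by_cases hJ : Submodule.comap (LinearMap.toSpanSingleton R R x) I ≤ D.F
  swap
  · exact D.fg_of_not_le_F hJ
  have hIF : I ≤ D.F := by
    intro a ha
    by_contra haF
    obtain ⟨r, hrF, hr⟩ := D.exists_mul_mem haF x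
    exact hrF (hJ ((Ideal.span_singleton_le_iff_mem I).2 ha hr))
  have hx : x ∉ D.F := by
    rintro ⟨N, hN⟩
    refine D.d_pow_notMem_F N (hJ ?_)
    rw [Submodule.mem_comap, LinearMap.toSpanSingleton_apply, smul_eq_mul, hN]
    exact zero_mem I
  obtain ⟨m, hm⟩ := D.exists_W_of_fg_of_le_F hI hIF
  obtain ⟨l, hl⟩ := D.exists_W_of_mul_mem_W hx m
  have : Submodule.comap (LinearMap.toSpanSingleton R R x) I =
      Ideal.span {y | y ∈ Submodule.comap (LinearMap.toSpanSingleton R R x) I ∧ y ∈ D.W l} := by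
    refine le_antisymm (fun a ha => ?_) (Submodule.span_le.2 fun y hy => hy.1)
    refine D.mem_of_mem_F (fun k y hy hyk => ?_) ha (hJ ha)
    obtain ⟨n, hn⟩ := D.exists_forall_mul_mem_W x k
    exact Ideal.subset_span ⟨hy, hl k y hyk (hm n _ hy (hn y hyk))⟩
  rw [this]
  exact D.fg_span_inter_W _ l

end IntegroDiffData

section Coherence

variable {R : Type*} [Ring R]

lemma Ideal.finitePresentation_sup_span_singleton {I : Ideal R} [Module.FinitePresentation R I]
    {x : R} (h : (Submodule.comap (LinearMap.toSpanSingleton R R x) I).FG) :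
    Module.FinitePresentation R ↥(I ⊔ Ideal.span {x}) := by
  let x' : ↥(I ⊔ Ideal.span {x}) :=
    ⟨x, Submodule.mem_sup_right (Ideal.mem_span_singleton_self x)⟩
  let l : (I × R) →ₗ[R] ↥(I ⊔ Ideal.span {x}) :=
    (Submodule.inclusion le_sup_left).coprod (LinearMap.toSpanSingleton R _ x')
  have hl : ∀ p : I × R, (l p : R) = p.1 + p.2 * x := fun p => rfl
  refine Module.finitePresentation_of_surjective l ?_ ?_
  · rintro ⟨y, hy⟩
    obtain ⟨a, ha, b, hb, rfl⟩ := Submodule.mem_sup.1 hy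
    obtain ⟨r, rfl⟩ := Ideal.mem_span_singleton'.1 hb
    exact ⟨(⟨a, ha⟩, r), Subtype.ext (hl _)⟩
  · let J := Submodule.comap (LinearMap.toSpanSingleton R R x) I
    let f : J →ₗ[R] (I × R) :=
      (-((LinearMap.toSpanSingleton R R x).restrict fun _ hr => hr : J →ₗ[R] I)).prod J.subtype
    have hf : ∀ r : J, ((f r).1 : R) = -(r * x) ∧ (f r).2 = r := fun r => ⟨rfl, rfl⟩
    have : l.ker = LinearMap.range f := by
      refine le_antisymm ?_ ?_
      · rintro ⟨a, r⟩ hp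
        have h1 : (a : R) + r * x = 0 := congrArg Subtype.val (LinearMap.mem_ker.1 hp)
        have h2 : r * x = -(a : R) := by rw [eq_neg_iff_add_eq_zero, add_comm, h1]
        refine ⟨⟨r, ?_⟩, Prod.ext (Subtype.ext ?_) rfl⟩
        · change r * x ∈ I
          rw [h2]
          exact neg_mem a.2
        · rw [(hf _).1, h2, neg_neg]
      · rintro _ ⟨r, rfl⟩
        rw [LinearMap.mem_ker]
        refine Subtype.ext ?_
        rw [hl, (hf r).1, (hf r).2, neg_add_cancel]
        rfl
    have : Module.Finite R J := Module.Finite.iff_fg.2 h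
    rw [‹l.ker = _›]
    exact Module.Finite.iff_fg.1 inferInstance

lemma Ideal.finitePresentation_of_fg
    (h : ∀ (I : Ideal R) (x : R), I.FG →
      (Submodule.comap (LinearMap.toSpanSingleton R R x) I).FG)
    {I : Ideal R} (hI : I.FG) : Module.FinitePresentation R I := by
  classical
  obtain ⟨S, rfl⟩ := hI
  induction S using Finset.induction_on with
  | empty =>
    have : Subsingleton ↥(Ideal.span ((∅ : Finset R) : Set R)) := by
      rw [Finset.coe_empty, Ideal.span_empty]
      infer_instance
    infer_instance
  | insert a S _ ih =>
    rw [Finset.coe_insert, Ideal.span_insert, sup_comm]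
    exact Ideal.finitePresentation_sup_span_singleton (h _ _ ⟨S, rfl⟩)

end Coherence

lemma IsFinitelyPresentedMod.of_finitePresentation {R M : Type*} [Ring R] [AddCommGroup M]
    [Module R M] [Module.FinitePresentation R M] : IsFinitelyPresentedMod R M := by
  obtain ⟨n, N, e, hN⟩ := Module.FinitePresentation.exists_fin R M
  obtain ⟨m, g, rfl⟩ := N.fg_iff_exists_fin_linearMap.1 hN
  exact ⟨n, m, g, ⟨e.symm⟩⟩

/-- A ring as a right module over itself is its opposite ring as a left module over itself. -/
def opSelfEquiv (R : Type*) [Ring R] : R ≃ₗ[Rᵐᵒᵖ] Rᵐᵒᵖ :=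
  { MulOpposite.opAddEquiv with map_smul' := fun _ _ => rfl }

theorem IntegroDiffData.coherent {K R : Type*} [Field K] [CharZero K] [Ring R] [Algebra K R]
    (D : IntegroDiffData K R) :
    (∀ I : Ideal R, I.FG → IsFinitelyPresentedMod R I) ∧
      (∀ I : Submodule Rᵐᵒᵖ R, I.FG → IsFinitelyPresentedMod Rᵐᵒᵖ I) := by
  refine ⟨fun I hI => ?_, fun I hI => ?_⟩
  · have := Ideal.finitePresentation_of_fg (fun J x hJ => D.fg_comap hJ x) hI
    exact .of_finitePresentation
  · have : Module.FinitePresentation Rᵐᵒᵖ (I.map (opSelfEquiv R).toLinearMap) :=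
      Ideal.finitePresentation_of_fg (fun J x hJ => D.op.fg_comap hJ x) (hI.map _)
    have := Module.FinitePresentation.of_equiv ((opSelfEquiv R).submoduleMap I).symm
    exact .of_finitePresentation

lemma end_ext_X_pow {f g : Module.End K K[X]} (H : ∀ n : ℕ, f (X ^ n) = g (X ^ n)) : f = g :=
  (Polynomial.basisMonomials K).ext fun n => by
    simpa [Polynomial.coe_basisMonomials, monomial_one_right_eq_X_pow] using H n

lemma derOp_X_pow (n : ℕ) : derOp K (X ^ n) = (n : K) • X ^ (n - 1) := by
  rw [derOp, derivative_X_pow, smul_eq_C_mul]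

lemma derOp_one : derOp K 1 = 0 := by simpa using derOp_X_pow K 0

lemma xOp_apply (p : K[X]) : xOp K p = X * p := rfl

lemma intOp_X_pow (n : ℕ) : intOp K (X ^ n) = ((n : K) + 1)⁻¹ • X ^ (n + 1) := by
  have := (Polynomial.basisMonomials K).constr_basis K
    (fun n => ((n : K) + 1)⁻¹ • (X : K[X]) ^ (n + 1)) n
  rw [Polynomial.coe_basisMonomials] at this
  simpa only [intOp, monomial_one_right_eq_X_pow] using this

lemma hOp_X_pow (n : ℕ) : hOp K (X ^ n) = ((n : K) + 1) • X ^ n := by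
  rw [hOp, Module.End.mul_apply, xOp_apply, ← pow_succ', derOp_X_pow]
  simp

lemma hOp_one : hOp K 1 = 1 := by simpa using hOp_X_pow K 0

lemma hOp_mem : hOp K ∈ I1 K := mul_mem (derOp_mem K) (xOp_mem K)

lemma derOp_mul_intOp : derOp K * intOp K = 1 := end_ext_X_pow K fun n => by
  have := Nat.cast_add_one_ne_zero (R := K) n
  simp [intOp_X_pow, derOp_X_pow, smul_smul, this]

lemma intOp_mul_hOp : intOp K * hOp K = xOp K := end_ext_X_pow K fun n => by
  have := Nat.cast_add_one_ne_zero (R := K) n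
  simp [intOp_X_pow, hOp_X_pow, smul_smul, this, xOp_apply, pow_succ']

lemma hOp_mul_intOp : hOp K * intOp K = xOp K + intOp K := end_ext_X_pow K fun n => by
  have := Nat.cast_add_one_ne_zero (R := K) n
  rw [Module.End.mul_apply, LinearMap.add_apply, intOp_X_pow, map_smul, hOp_X_pow, xOp_apply,
    smul_smul, ← pow_succ', ← one_smul K (X ^ (n + 1)), smul_smul, smul_smul, ← add_smul]
  congr 1
  push_cast
  field_simp

lemma hOp_mul_derOp : hOp K * derOp K = derOp K * hOp K - derOp K := end_ext_X_pow K fun n => by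
  cases n with
  | zero => simp [derOp_one, hOp_one]
  | succ n =>
    simp [derOp_X_pow, hOp_X_pow, smul_smul, ← sub_smul]
    ring_nf

lemma intOp_mul_derOp_X_pow (n : ℕ) :
    (1 - intOp K * derOp K) (X ^ n) = if n = 0 then 1 else 0 := by
  cases n with
  | zero => simp [derOp_one]
  | succ n =>
    have := Nat.cast_add_one_ne_zero (R := K) n
    simp [derOp_X_pow, intOp_X_pow, smul_smul, this]

/-- The operators `∂`, `∫` and `H` in `I₁`. -/
def integroDiffData : IntegroDiffData K (I1 K) where
  d := derI K
  s := intI K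
  h := ⟨hOp K, hOp_mem K⟩
  d_mul_s := Subtype.ext (derOp_mul_intOp K)
  h_mul_d := Subtype.ext (hOp_mul_derOp K)
  s_mul_h := Subtype.ext <| (intOp_mul_hOp K).trans (by
    change _ = hOp K * intOp K - intOp K
    rw [hOp_mul_intOp, add_sub_cancel_right])
  idem_mul_h := Subtype.ext <| end_ext_X_pow K fun n => by
    change (1 - intOp K * derOp K) (hOp K (X ^ n)) = (1 - intOp K * derOp K) (X ^ n)
    rw [hOp_X_pow, map_smul, intOp_mul_derOp_X_pow]
    split_ifs with hn <;> simp [hn]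
  h_mul_idem := Subtype.ext <| end_ext_X_pow K fun n => by
    change hOp K ((1 - intOp K * derOp K) (X ^ n)) = (1 - intOp K * derOp K) (X ^ n)
    rw [intOp_mul_derOp_X_pow]
    split_ifs
    · exact hOp_one K
    · simp
  idem_ne_zero H := by
    have h1 := intOp_mul_derOp_X_pow K 0
    have h2 : 1 - intOp K * derOp K = 0 := congrArg Subtype.val H
    rw [h2] at h1
    simp at h1
  eq_top S hd hs hh := by
    have hle : I1 K ≤ S.map (I1 K).val := by
      refine Algebra.adjoin_le ?_
      rintro _ (rfl | rfl | rfl)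
      · exact ⟨_, mul_mem hs hh, intOp_mul_hOp K⟩
      · exact ⟨_, hd, rfl⟩
      · exact ⟨_, hs, rfl⟩
    refine eq_top_iff.2 fun a _ => ?_
    obtain ⟨b, hb, hba⟩ := hle a.2
    exact Subtype.ext hba ▸ hb

/-- `I₁` is left and right coherent: every finitely generated left (resp.
right) ideal is finitely presented. -/
theorem statement8 :
    (∀ I : Ideal (I1 K), I.FG → IsFinitelyPresentedMod (I1 K) ↥I)
    ∧ (∀ I : Submodule ((I1 K)ᵐᵒᵖ) (I1 K), I.FG →
        IsFinitelyPresentedMod ((I1 K)ᵐᵒᵖ) ↥I) := by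
  exact (integroDiffData K).coherent

end
end

section
/- For a ∈ I₁, the K-vector space Cen_F(a) := {f ∈ F : af = fa} is finite-dimensional if and only if a ∉ K[H] + F. -/
open Polynomial

noncomputable section
set_option synthInstance.maxHeartbeats 1000000
set_option maxHeartbeats 1000000
set_option linter.unusedSectionVars false

variable (K : Type*) [Field K] [CharZero K]

/-- The basis `xⁿ / n!` of `K[x]` of divided powers. -/
def divBasis : Module.Basis ℕ K (Polynomial K) :=
  (Polynomial.basisMonomials K).isUnitSMul (w := fun n => ((n.factorial : K))⁻¹)
    fun n => (inv_ne_zero (Nat.cast_ne_zero.2 n.factorial_ne_zero)).isUnit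

lemma divBasis_apply (n : ℕ) :
    divBasis K n = monomial n ((n.factorial : K))⁻¹ := by
  simp [divBasis, Module.Basis.isUnitSMul_apply, smul_monomial]

lemma derOp_divBasis_zero : derOp K (divBasis K 0) = 0 := by
  simp [derOp, divBasis_apply]

lemma derOp_divBasis_succ (n : ℕ) : derOp K (divBasis K (n + 1)) = divBasis K n := by
  have h : (n.factorial : K) ≠ 0 := Nat.cast_ne_zero.2 n.factorial_ne_zero
  have h' : (n : K) + 1 ≠ 0 := Nat.cast_add_one_ne_zero n
  simp only [derOp, divBasis_apply, derivative_monomial, Nat.add_sub_cancel, Nat.factorial_succ]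
  congr 1
  push_cast
  field_simp

lemma intOp_divBasis (n : ℕ) : intOp K (divBasis K n) = divBasis K (n + 1) := by
  have h : (n.factorial : K) ≠ 0 := Nat.cast_ne_zero.2 n.factorial_ne_zero
  have h' : (n : K) + 1 ≠ 0 := Nat.cast_add_one_ne_zero n
  have e : divBasis K n = ((n.factorial : K))⁻¹ • Polynomial.basisMonomials K n := by
    simp [divBasis_apply, smul_monomial]
  rw [e, map_smul, intOp, Module.Basis.constr_basis, divBasis_apply, ← monomial_one_right_eq_X_pow,
    smul_monomial, smul_monomial, Nat.factorial_succ]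
  congr 1
  push_cast
  simp only [smul_eq_mul]
  field_simp

lemma xOp_divBasis (n : ℕ) :
    xOp K (divBasis K n) = ((n : K) + 1) • divBasis K (n + 1) := by
  have h : (n.factorial : K) ≠ 0 := Nat.cast_ne_zero.2 n.factorial_ne_zero
  have h' : (n : K) + 1 ≠ 0 := Nat.cast_add_one_ne_zero n
  simp only [xOp, divBasis_apply, LinearMap.mulLeft_apply, X_mul_monomial, smul_monomial,
    Nat.factorial_succ]
  congr 1
  push_cast
  simp only [smul_eq_mul]
  field_simp

lemma hOp_divBasis (n : ℕ) : hOp K (divBasis K n) = ((n : K) + 1) • divBasis K n := by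
  rw [hOp, Module.End.mul_apply, xOp_divBasis, map_smul, derOp_divBasis_succ]

lemma intOp_pow_divBasis (i n : ℕ) : (intOp K ^ i) (divBasis K n) = divBasis K (n + i) := by
  induction i with
  | zero => simp
  | succ i ih => rw [pow_succ', Module.End.mul_apply, ih, intOp_divBasis, add_assoc]

lemma derOp_pow_divBasis (j n : ℕ) :
    (derOp K ^ j) (divBasis K n) = if j ≤ n then divBasis K (n - j) else 0 := by
  induction j generalizing n with
  | zero => simp
  | succ j ih =>
    rw [pow_succ, Module.End.mul_apply]
    cases n with
    | zero => simp [derOp_divBasis_zero]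
    | succ n => simp [derOp_divBasis_succ, ih]

lemma eOp_divBasis (i j n : ℕ) :
    eOp K i j (divBasis K n) = if n = j then divBasis K i else 0 := by
  rw [eOp, LinearMap.sub_apply, Module.End.mul_apply, Module.End.mul_apply,
    derOp_pow_divBasis, derOp_pow_divBasis]
  rcases lt_trichotomy n j with h | h | h
  · simp [h.not_ge, h.ne, (Nat.lt_succ_of_lt h).not_ge]
  · subst h
    simp [intOp_pow_divBasis]
  · rw [if_pos h.le, if_pos (Nat.succ_le_of_lt h), if_neg h.ne', intOp_pow_divBasis,
      intOp_pow_divBasis, sub_eq_zero]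
    congr 1
    omega

/-- The matrix entries of an endomorphism of `K[x]` in the basis of divided powers. -/
def entry (i j : ℕ) : Module.End K (Polynomial K) →ₗ[K] K :=
  (divBasis K).coord i ∘ₗ LinearMap.applyₗ (divBasis K j)

lemma entry_apply (i j : ℕ) (a : Module.End K (Polynomial K)) :
    entry K i j a = (divBasis K).repr (a (divBasis K j)) i := rfl

variable {K} in
lemma ext_entry {a b : Module.End K (Polynomial K)} (h : ∀ i j, entry K i j a = entry K i j b) :
    a = b :=
  (divBasis K).ext fun j => (divBasis K).ext_elem fun i => h i j

lemma entry_one (i j : ℕ) : entry K i j 1 = if i = j then 1 else 0 := by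
  simp [entry_apply, Finsupp.single_apply, eq_comm]

lemma entry_eOp (i j k l : ℕ) : entry K k l (eOp K i j) = if k = i ∧ l = j then 1 else 0 := by
  rw [entry_apply, eOp_divBasis]
  split_ifs <;> simp_all [eq_comm]

lemma entry_mul_intOp (a : Module.End K (Polynomial K)) (i j : ℕ) :
    entry K i j (a * intOp K) = entry K i (j + 1) a := by
  simp [entry_apply, intOp_divBasis]

lemma entry_mul_xOp (a : Module.End K (Polynomial K)) (i j : ℕ) :
    entry K i j (a * xOp K) = (j + 1) * entry K i (j + 1) a := by
  simp [entry_apply, xOp_divBasis]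

lemma entry_mul_derOp_zero (a : Module.End K (Polynomial K)) (i : ℕ) :
    entry K i 0 (a * derOp K) = 0 := by
  simp [entry_apply, derOp_divBasis_zero]

lemma entry_mul_derOp_succ (a : Module.End K (Polynomial K)) (i j : ℕ) :
    entry K i (j + 1) (a * derOp K) = entry K i j a := by
  simp [entry_apply, derOp_divBasis_succ]

lemma entry_mul (f g : Module.End K (Polynomial K)) (i j R : ℕ)
    (h : ∀ k, R ≤ k → entry K i k f * entry K k j g = 0) :
    entry K i j (f * g) = ∑ k ∈ Finset.range R, entry K i k f * entry K k j g := by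
  set s := ((divBasis K).repr (g (divBasis K j))).support
  have e : entry K i j (f * g) = ∑ k ∈ s, entry K i k f * entry K k j g := by
    rw [entry_apply, Module.End.mul_apply]
    conv_lhs => rw [← (divBasis K).linearCombination_repr (g (divBasis K j))]
    simp [Finsupp.linearCombination_apply, Finsupp.sum, entry_apply, mul_comm, s,
      Finsupp.finsetSum_apply]
  rw [e]
  have h1 : ∑ k ∈ s, entry K i k f * entry K k j g =
      ∑ k ∈ s ∪ Finset.range R, entry K i k f * entry K k j g := by
    refine Finset.sum_subset Finset.subset_union_left fun k _ hk => ?_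
    rw [entry_apply K k j g, Finsupp.notMem_support_iff.1 hk, mul_zero]
  rw [h1]
  exact (Finset.sum_subset Finset.subset_union_right fun k _ hk =>
    h k (by simpa using hk)).symm

/-- The endomorphisms whose matrix vanishes outside the top left `R × R` corner lie in `F`. -/
lemma mem_Fset_of_entry_eq_zero (a : Module.End K (Polynomial K)) (R : ℕ)
    (h : ∀ i j, R ≤ i ∨ R ≤ j → entry K i j a = 0) : a ∈ Fset K := by
  have e : a = ∑ i ∈ Finset.range R, ∑ j ∈ Finset.range R, entry K i j a • eOp K i j := by
    refine ext_entry fun k l => ?_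
    simp only [map_sum, map_smul, entry_eOp, smul_eq_mul, mul_ite, mul_one, mul_zero, ite_and]
    by_cases hk : k < R <;> by_cases hl : l < R
    · simp [hk, hl]
    all_goals
      rw [h k l (by omega)]
      simp [hk, hl]
  rw [e]
  exact Submodule.sum_mem _ fun i _ => Submodule.sum_mem _ fun j _ =>
    Submodule.smul_mem _ _ (Submodule.subset_span ⟨i, j, rfl⟩)

lemma exists_entry_eq_zero_of_mem_Fset {f : Module.End K (Polynomial K)} (hf : f ∈ Fset K) :
    ∃ R : ℕ, ∀ i j, R ≤ i ∨ R ≤ j → entry K i j f = 0 := by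
  induction hf using Submodule.span_induction with
  | mem f hf =>
    obtain ⟨i, j, rfl⟩ := hf
    refine ⟨i + j + 1, fun k l hkl => ?_⟩
    rw [entry_eOp, if_neg (by omega)]
  | zero => exact ⟨0, fun i j _ => map_zero _⟩
  | add f g _ _ hf hg =>
    obtain ⟨R, hR⟩ := hf
    obtain ⟨S, hS⟩ := hg
    refine ⟨R + S, fun i j hij => ?_⟩
    rw [map_add, hR i j (by omega), hS i j (by omega), add_zero]
  | smul c f _ hf =>
    obtain ⟨R, hR⟩ := hf
    exact ⟨R, fun i j hij => by rw [map_smul, hR i j hij, smul_zero]⟩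

/-- Every element of `K[H]` acts diagonally on the basis of divided powers. -/
lemma entry_eq_zero_of_mem_KH {a : Module.End K (Polynomial K)} (ha : a ∈ KH K) {i j : ℕ}
    (hij : i ≠ j) : entry K i j a = 0 := by
  suffices h : ∀ j, ∃ c : K, a (divBasis K j) = c • divBasis K j by
    obtain ⟨c, hc⟩ := h j
    simp [entry_apply, hc, hij.symm]
  intro j
  induction ha using Algebra.adjoin_induction with
  | mem a ha => rw [Set.mem_singleton_iff.1 ha]; exact ⟨_, hOp_divBasis K j⟩
  | algebraMap r => exact ⟨r, by simp [Module.algebraMap_end_apply]⟩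
  | add a b _ _ ha hb =>
    obtain ⟨c, hc⟩ := ha
    obtain ⟨d, hd⟩ := hb
    exact ⟨c + d, by rw [LinearMap.add_apply, hc, hd, add_smul]⟩
  | mul a b _ _ ha hb =>
    obtain ⟨c, hc⟩ := ha
    obtain ⟨d, hd⟩ := hb
    exact ⟨d * c, by rw [Module.End.mul_apply, hd, map_smul, hc, smul_smul]⟩

lemma aeval_hOp_divBasis (q : Polynomial K) (n : ℕ) :
    aeval (hOp K) q (divBasis K n) = q.eval ((n : K) + 1) • divBasis K n := by
  induction q using Polynomial.induction_on' with
  | add p q hp hq => simp [hp, hq, add_smul]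
  | monomial k c =>
    have h : (hOp K ^ k) (divBasis K n) = ((n : K) + 1) ^ k • divBasis K n := by
      induction k with
      | zero => simp
      | succ k ih => rw [pow_succ', Module.End.mul_apply, ih, map_smul, hOp_divBasis, smul_smul,
          pow_succ]
    rw [aeval_monomial, Module.End.mul_apply, h, Module.algebraMap_end_apply, eval_monomial,
      smul_smul]

/-- If `a` is, up to finitely many rows and columns, diagonal, then it commutes with infinitely
many of the matrix units `e_{nn}`. -/
lemma not_finiteDimensional_CenF {a : Module.End K (Polynomial K)} (N : ℕ)
    (h : ∀ i j, i ≠ j → N ≤ i ∨ N ≤ j → entry K i j a = 0) :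
    ¬ FiniteDimensional K ↥(CenF K a) := by
  intro hfin
  have hmem : ∀ n, eOp K (N + n) (N + n) ∈ CenF K a := by
    intro n
    refine ⟨Submodule.subset_span ⟨_, _, rfl⟩, ?_⟩
    simp only [SetLike.mem_coe, Subalgebra.mem_toSubmodule, Subalgebra.mem_centralizer_iff,
      Set.mem_singleton_iff, forall_eq]
    refine ext_entry fun i j => ?_
    rw [entry_mul K _ _ i j (N + n + 1) (fun k hk => by
        rw [entry_eOp, if_neg (by omega), mul_zero]),
      entry_mul K _ _ i j (N + n + 1) (fun k hk => by
        rw [entry_eOp, if_neg (by omega), zero_mul])]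
    simp only [entry_eOp, ite_and, mul_ite, ite_mul, mul_one, one_mul, mul_zero, zero_mul]
    by_cases hi : i = N + n <;> by_cases hj : j = N + n
    · simp [hi, hj]
    · simp [hi, hj, h (N + n) j (fun e => hj e.symm) (by omega)]
    · simp [hi, hj, h i (N + n) hi (by omega)]
    · simp [hi, hj]
  let φ : ↥(CenF K a) →ₗ[K] (ℕ → K) :=
    (LinearMap.pi fun n => entry K (N + n) (N + n)) ∘ₗ (CenF K a).subtype
  have hli : LinearIndependent K (fun n => (⟨_, hmem n⟩ : CenF K a)) := by
    refine LinearIndependent.of_comp φ ?_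
    convert Pi.linearIndependent_single_one ℕ K using 1
    funext n m
    simp [φ, entry_eOp, Pi.single_apply]
  exact not_finite_iff_infinite.2 inferInstance hli.finite

/-- Suppose that far enough down the matrix `A` the outermost nonzero diagonal below the main one is
the `d`-th, with `d > 0`, and that its entries there do not vanish.  Then a finite matrix which
commutes with `A` is determined by its top left corner. -/
lemma eq_zero_of_commute_of_corner {A f : ℕ → ℕ → K} {d M R : ℕ} (hd : 0 < d)
    (hne : ∀ j, M ≤ j → A (j + d) j ≠ 0)
    (hrow : ∀ j k, M ≤ j → k < j → A (j + d) k = 0)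
    (hcol : ∀ j k, M ≤ j → j + d < k → A k j = 0)
    (hf : ∀ i j, R ≤ i ∨ R ≤ j → f i j = 0)
    (hcomm : ∀ i j, ∑ k ∈ Finset.range R, A i k * f k j = ∑ k ∈ Finset.range R, f i k * A k j)
    (hcorner : ∀ i j, i < M + d → j < M + d → f i j = 0) : f = 0 := by
  have sum_single : ∀ (g : ℕ → K) (m : ℕ), (R ≤ m → g m = 0) → (∀ k, k ≠ m → g k = 0) →
      ∑ k ∈ Finset.range R, g k = g m := fun g m hm hk =>
    Finset.sum_eq_single m (fun k _ => hk k) fun h => hm (by simpa using h)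
  have rows : ∀ n i j, M ≤ i → R ≤ i + n → f i j = 0 := by
    intro n
    induction n with
    | zero => exact fun i j _ h => hf i j (Or.inl h)
    | succ n ih =>
      intro i j hi hn
      have h := hcomm (i + d) j
      rw [sum_single _ i (fun h => by rw [hf i j (Or.inl h), mul_zero]) (fun k hk => by
          rcases lt_or_gt_of_ne hk with hk | hk
          · rw [hrow i k hi hk, zero_mul]
          · rw [ih k j (by omega) (by omega), mul_zero]),
        Finset.sum_eq_zero (fun k _ => by rw [ih (i + d) k (by omega) (by omega), zero_mul])] at h
      exact (mul_eq_zero.1 h).resolve_left (hne i hi)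
  have cols : ∀ j i, f i j = 0 := by
    intro j
    induction j using Nat.strong_induction_on with
    | _ j ih =>
      intro i
      by_cases hi : M ≤ i
      · exact rows R i j hi (by omega)
      by_cases hj : j < M + d
      · exact hcorner i j (by omega) hj
      obtain ⟨l, rfl⟩ : ∃ l, j = l + d := ⟨j - d, by omega⟩
      have h := hcomm i l
      rw [Finset.sum_eq_zero (fun k _ => by rw [ih l (by omega) k, mul_zero]),
        sum_single _ (l + d) (fun h => by rw [hf i _ (Or.inr h), zero_mul]) (fun k hk => by
          rcases lt_or_gt_of_ne hk with hk | hk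
          · rw [ih k hk i, zero_mul]
          · rw [hcol l k (by omega) hk, mul_zero])] at h
      exact (mul_eq_zero.1 h.symm).resolve_right (hne l (by omega))
  funext i j
  exact cols j i

/-- Elements of `Cen_F(a)` are matrices with finite support commuting with that of `a`. -/
lemma exists_sum_entry_of_mem_CenF {a f : Module.End K (Polynomial K)} (hf : f ∈ CenF K a) :
    ∃ R : ℕ, (∀ i j, R ≤ i ∨ R ≤ j → entry K i j f = 0) ∧
      ∀ i j, ∑ k ∈ Finset.range R, entry K i k a * entry K k j f =
        ∑ k ∈ Finset.range R, entry K i k f * entry K k j a := by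
  obtain ⟨hF, hc⟩ := hf
  obtain ⟨R, hR⟩ := exists_entry_eq_zero_of_mem_Fset K hF
  simp only [SetLike.mem_coe, Subalgebra.mem_toSubmodule, Subalgebra.mem_centralizer_iff,
    Set.mem_singleton_iff, forall_eq] at hc
  refine ⟨R, hR, fun i j => ?_⟩
  rw [← entry_mul K _ _ i j R (fun k hk => by rw [hR k j (Or.inl hk), mul_zero]),
    ← entry_mul K _ _ i j R (fun k hk => by rw [hR i k (Or.inr hk), zero_mul]), hc]

lemma finiteDimensional_CenF_of_corner {a : Module.End K (Polynomial K)} (M : ℕ)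
    (h : ∀ f ∈ CenF K a, (∀ i j, i < M → j < M → entry K i j f = 0) → f = 0) :
    FiniteDimensional K ↥(CenF K a) := by
  let φ : ↥(CenF K a) →ₗ[K] (Fin M × Fin M → K) :=
    (LinearMap.pi fun q => entry K q.1 q.2) ∘ₗ (CenF K a).subtype
  have hφ : Function.Injective φ := by
    refine fun f g hfg => Subtype.ext (sub_eq_zero.1 (h _ (sub_mem f.2 g.2) fun i j hi hj => ?_))
    rw [map_sub, sub_eq_zero]
    exact congrFun hfg (⟨i, hi⟩, ⟨j, hj⟩)
  exact FiniteDimensional.of_injective φ hφ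

/-- An endomorphism is banded with diagonals `p` if its matrix is supported near the main diagonal,
and far enough to the right, the `d`-th diagonal is given by the polynomial `p d`. -/
def IsPolyBanded (a : Module.End K (Polynomial K)) : Prop :=
  ∃ (N : ℕ) (p : ℤ → Polynomial K), (∀ i j, i + N < j ∨ j + N < i → entry K i j a = 0) ∧
    ∀ i j : ℕ, N ≤ j → entry K i j a = (p ((i : ℤ) - j)).eval (j : K)

lemma IsPolyBanded.one : IsPolyBanded K 1 := by
  refine ⟨0, fun d => if d = 0 then 1 else 0, fun i j h => ?_, fun i j _ => ?_⟩
  · rw [entry_one, if_neg (by omega)]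
  · rw [entry_one]
    by_cases h : i = j
    · simp [h]
    · simp [h, sub_eq_zero]

variable {K}

lemma IsPolyBanded.add {a b : Module.End K (Polynomial K)} (ha : IsPolyBanded K a)
    (hb : IsPolyBanded K b) : IsPolyBanded K (a + b) := by
  obtain ⟨N, p, h1, h2⟩ := ha
  obtain ⟨N', p', h1', h2'⟩ := hb
  refine ⟨N + N', fun d => p d + p' d, fun i j h => ?_, fun i j h => ?_⟩
  · rw [map_add, h1 i j (by omega), h1' i j (by omega), add_zero]
  · rw [map_add, h2 i j (by omega), h2' i j (by omega), eval_add]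

lemma IsPolyBanded.smul {a : Module.End K (Polynomial K)} (c : K) (ha : IsPolyBanded K a) :
    IsPolyBanded K (c • a) := by
  obtain ⟨N, p, h1, h2⟩ := ha
  refine ⟨N, fun d => C c * p d, fun i j h => ?_, fun i j h => ?_⟩
  · rw [map_smul, h1 i j h, smul_zero]
  · rw [map_smul, h2 i j h, eval_mul, eval_C, smul_eq_mul]

lemma IsPolyBanded.mul_intOp {a : Module.End K (Polynomial K)} (ha : IsPolyBanded K a) :
    IsPolyBanded K (a * intOp K) := by
  obtain ⟨N, p, h1, h2⟩ := ha
  refine ⟨N + 1, fun d => (p (d - 1)).comp (X + 1), fun i j h => ?_, fun i j h => ?_⟩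
  · rw [entry_mul_intOp, h1 i (j + 1) (by omega)]
  · rw [entry_mul_intOp, h2 i (j + 1) (by omega)]
    simp [sub_sub]

lemma IsPolyBanded.mul_xOp {a : Module.End K (Polynomial K)} (ha : IsPolyBanded K a) :
    IsPolyBanded K (a * xOp K) := by
  obtain ⟨N, p, h1, h2⟩ := ha
  refine ⟨N + 1, fun d => (X + 1) * (p (d - 1)).comp (X + 1), fun i j h => ?_, fun i j h => ?_⟩
  · rw [entry_mul_xOp, h1 i (j + 1) (by omega), mul_zero]
  · rw [entry_mul_xOp, h2 i (j + 1) (by omega)]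
    simp [sub_sub]

lemma IsPolyBanded.mul_derOp {a : Module.End K (Polynomial K)} (ha : IsPolyBanded K a) :
    IsPolyBanded K (a * derOp K) := by
  obtain ⟨N, p, h1, h2⟩ := ha
  refine ⟨N + 1, fun d => (p (d + 1)).comp (X - 1), fun i j h => ?_, fun i j h => ?_⟩
  · cases j with
    | zero => rw [entry_mul_derOp_zero]
    | succ j => rw [entry_mul_derOp_succ, h1 i j (by omega)]
  · cases j with
    | zero => omega
    | succ j =>
      rw [entry_mul_derOp_succ, h2 i j (by omega)]
      simp [sub_add]

variable (K)

lemma isPolyBanded_of_mem_I1 {a : Module.End K (Polynomial K)} (ha : a ∈ I1 K) :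
    IsPolyBanded K a := by
  suffices h : ∀ b, IsPolyBanded K b → IsPolyBanded K (b * a) by
    simpa using h 1 (IsPolyBanded.one K)
  induction ha using Algebra.adjoin_induction with
  | mem c hc =>
    rcases hc with rfl | rfl | rfl
    · exact fun b hb => hb.mul_xOp
    · exact fun b hb => hb.mul_derOp
    · exact fun b hb => hb.mul_intOp
  | algebraMap r =>
    intro b hb
    rw [Algebra.algebraMap_eq_smul_one, mul_smul_comm, mul_one]
    exact hb.smul r
  | add c c' _ _ hc hc' =>
    intro b hb
    rw [mul_add]
    exact (hc b hb).add (hc' b hb)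
  | mul c c' _ _ hc hc' =>
    intro b hb
    rw [← mul_assoc]
    exact hc' _ (hc b hb)

lemma exists_forall_eval_natCast_ne_zero {p : Polynomial K} (hp : p ≠ 0) :
    ∃ M : ℕ, ∀ j : ℕ, M ≤ j → p.eval (j : K) ≠ 0 := by
  have hfin : {j : ℕ | p.eval (j : K) = 0}.Finite :=
    (Polynomial.finite_setOfPred_isRoot hp).preimage Nat.cast_injective.injOn
  obtain ⟨M, hM⟩ := hfin.bddAbove
  exact ⟨M + 1, fun j hj h => absurd (hM h) (by omega)⟩

/-- A polynomially banded endomorphism all of whose off-diagonals eventually vanish is in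
`K[H] + F`. -/
lemma mem_KH_sup_Fset {a : Module.End K (Polynomial K)} {N : ℕ} {p : ℤ → Polynomial K}
    (h1 : ∀ i j, i + N < j ∨ j + N < i → entry K i j a = 0)
    (h2 : ∀ i j : ℕ, N ≤ j → entry K i j a = (p ((i : ℤ) - j)).eval (j : K))
    (hp : ∀ d, d ≠ 0 → p d = 0) : a ∈ Subalgebra.toSubmodule (KH K) ⊔ Fset K := by
  set b := aeval (hOp K) ((p 0).comp (X - 1)) with hb
  have hbK : b ∈ KH K := aeval_mem_adjoin_singleton K (hOp K)
  have hbe : ∀ i j, entry K i j b = if i = j then (p 0).eval (j : K) else 0 := by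
    intro i j
    rw [entry_apply, hb, aeval_hOp_divBasis]
    simp [Finsupp.single_apply, eq_comm]
  refine Submodule.mem_sup.2 ⟨b, hbK, a - b, ?_, add_sub_cancel b a⟩
  refine mem_Fset_of_entry_eq_zero K _ (N + N) fun i j hij => ?_
  rw [map_sub, hbe]
  by_cases hj : N ≤ j
  · rw [h2 i j hj]
    by_cases h : i = j
    · simp [h]
    · rw [hp _ (by omega), if_neg h, eval_zero, sub_zero]
  · rw [h1 i j (by omega), if_neg (by omega), sub_zero]

lemma finiteDimensional_CenF_of_diagonal {a : Module.End K (Polynomial K)} {N : ℕ}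
    {p : ℤ → Polynomial K}
    (h1 : ∀ i j, i + N < j ∨ j + N < i → entry K i j a = 0)
    (h2 : ∀ i j : ℕ, N ≤ j → entry K i j a = (p ((i : ℤ) - j)).eval (j : K))
    {d : ℤ} (hd : d ≠ 0) (hp : p d ≠ 0) : FiniteDimensional K ↥(CenF K a) := by
  have hbound : ∀ d, p d ≠ 0 → -(N : ℤ) ≤ d ∧ d ≤ N := by
    intro d hd
    obtain ⟨M, hM⟩ := exists_forall_eval_natCast_ne_zero K hd
    by_contra hN
    obtain ⟨i, hi⟩ : ∃ i : ℕ, (i : ℤ) = d + ((M + N + d.natAbs : ℕ) : ℤ) :=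
      ⟨(d + ((M + N + d.natAbs : ℕ) : ℤ)).toNat, by omega⟩
    have e := h2 i (M + N + d.natAbs) (by omega)
    rw [h1 _ _ (by omega), hi, add_sub_cancel_right] at e
    exact hM _ (by omega) e.symm
  rcases lt_or_gt_of_ne hd with hd | hd
  · obtain ⟨m, hm, hmin⟩ := Int.exists_least_of_bdd (P := fun d => p d ≠ 0)
      ⟨-N, fun z hz => (hbound z hz).1⟩ ⟨d, hp⟩
    have hmd := hmin d hp
    obtain ⟨e, rfl⟩ : ∃ e : ℕ, m = -e := ⟨m.natAbs, by omega⟩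
    have hlow : ∀ z, z < -(e : ℤ) → p z = 0 := fun z hz => by
      by_contra h
      exact absurd (hmin z h) (by omega)
    obtain ⟨M, hM⟩ := exists_forall_eval_natCast_ne_zero K hm
    refine finiteDimensional_CenF_of_corner K (M + N + e) fun f hf hcorner => ?_
    obtain ⟨R, hR, hcomm⟩ := exists_sum_entry_of_mem_CenF K hf
    have := eq_zero_of_commute_of_corner K (A := fun i j => entry K j i a)
      (f := fun i j => entry K j i f) (d := e) (M := M + N) (R := R) (by omega)
      (fun j hj => by
        rw [h2 _ _ (by omega), show (j : ℤ) - (j + e : ℕ) = -e by push_cast; ring]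
        exact hM _ (by omega))
      (fun j k hj hk => by rw [h2 _ _ (by omega), hlow _ (by omega), eval_zero])
      (fun j k hj hk => by rw [h2 _ _ (by omega), hlow _ (by omega), eval_zero])
      (fun i j hij => hR j i hij.symm)
      (fun i j => by simpa only [mul_comm] using (hcomm j i).symm)
      (fun i j hi hj => hcorner j i hj hi)
    exact ext_entry fun i j => by simpa using congrFun (congrFun this j) i
  · obtain ⟨m, hm, hmax⟩ := Int.exists_greatest_of_bdd (P := fun d => p d ≠ 0)
      ⟨N, fun z hz => (hbound z hz).2⟩ ⟨d, hp⟩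
    have hmd := hmax d hp
    obtain ⟨e, rfl⟩ : ∃ e : ℕ, m = e := ⟨m.natAbs, by omega⟩
    have hhigh : ∀ z, (e : ℤ) < z → p z = 0 := fun z hz => by
      by_contra h
      exact absurd (hmax z h) (by omega)
    obtain ⟨M, hM⟩ := exists_forall_eval_natCast_ne_zero K hm
    refine finiteDimensional_CenF_of_corner K (M + 2 * N + e) fun f hf hcorner => ?_
    obtain ⟨R, hR, hcomm⟩ := exists_sum_entry_of_mem_CenF K hf
    have := eq_zero_of_commute_of_corner K (A := fun i j => entry K i j a)
      (f := fun i j => entry K i j f) (d := e) (M := M + 2 * N) (R := R) (by omega)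
      (fun j hj => by
        rw [h2 _ _ (by omega), show ((j + e : ℕ) : ℤ) - j = e by push_cast; ring]
        exact hM _ (by omega))
      (fun j k hj hk => by
        by_cases hk' : N ≤ k
        · rw [h2 _ _ hk', hhigh _ (by omega), eval_zero]
        · exact h1 _ _ (by omega))
      (fun j k hj hk => by rw [h2 _ _ (by omega), hhigh _ (by omega), eval_zero])
      hR hcomm hcorner
    exact ext_entry fun i j => by simpa using congrFun (congrFun this i) j

/-- for `a ∈ I₁`, the space `Cen_F(a) = {f ∈ F : af = fa}` is
finite-dimensional over `K` iff `a ∉ K[H] + F`. -/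
theorem statement11 (a : Module.End K (Polynomial K)) (ha : a ∈ I1 K) :
    FiniteDimensional K ↥(CenF K a) ↔
      a ∉ Subalgebra.toSubmodule (KH K) ⊔ Fset K := by
  constructor
  · intro hfin hmem
    obtain ⟨b, hb, f, hf, rfl⟩ := Submodule.mem_sup.1 hmem
    obtain ⟨R, hR⟩ := exists_entry_eq_zero_of_mem_Fset K hf
    refine not_finiteDimensional_CenF K R (fun i j hij h => ?_) hfin
    rw [map_add, entry_eq_zero_of_mem_KH K hb hij, hR i j h, add_zero]
  · intro hmem
    obtain ⟨N, p, h1, h2⟩ := isPolyBanded_of_mem_I1 K ha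
    by_cases hp : ∀ d, d ≠ 0 → p d = 0
    · exact absurd (mem_KH_sup_Fset K h1 h2 hp) hmem
    · push Not at hp
      obtain ⟨d, hd, hpd⟩ := hp
      exact finiteDimensional_CenF_of_diagonal K h1 h2 hd hpd

end
end
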